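/- For every integer x with 0 ≤ x < q, every integer s with 0 ≤ s < q, and every r ∈ {0,1}, the number of elements R ∈ D_x such that the triple (s, r, R) is successful is at most u_x. -/

import Mathlib

open Polynomial

/-- The Frobenius orbit of `β`: `{β^(2^j) : 0 ≤ j < n}`. -/
def frobOrbit {L : Type*} [Monoid L] (n : ℕ) (β : L) : Set L :=
  {γ | ∃ j < n, γ = β ^ 2 ^ j}

/-- `u_x`: the number of Frobenius orbits (of elements of `L^×`) contained in `D`. -/
noncomputable def numOrbits {L : Type*} [Monoid L] [Zero L] (n : ℕ) (D : Set L) : ℕ :=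
  Set.ncard {O : Set L | (∃ β : L, β ≠ 0 ∧ O = frobOrbit n β) ∧ O ⊆ D}

theorem aeval_pow_two_pow {L : Type*} [Field L] [Algebra (ZMod 2) L] (P : Polynomial (ZMod 2))
    (R : L) (j : ℕ) : aeval (R ^ 2 ^ j) P = (aeval R P) ^ 2 ^ j := by
  induction j with
  | zero => simp
  | succ j ih =>
    rw [pow_succ, pow_mul, pow_mul, ← ih, ← expand_aeval, ZMod.expand_card, map_pow]

theorem mem_frobOrbit_self {L : Type*} [Monoid L] {n : ℕ} (hn : 0 < n) (β : L) :
    β ∈ frobOrbit n β :=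
  ⟨0, hn, by simp⟩

/-- An element of order `2 ^ n - 1` is fixed by no nontrivial power of Frobenius below the `n`-th. -/
theorem eq_zero_of_pow_two_pow_eq_self {L : Type*} [Field L] {n j : ℕ} {g : L} (hg0 : g ≠ 0)
    (hg : orderOf g = 2 ^ n - 1) (hj : j < n) (h : g ^ 2 ^ j = g) : j = 0 := by
  have hpow : g ^ (2 ^ j - 1) = 1 := by
    apply mul_right_cancel₀ hg0
    rw [← pow_succ, Nat.sub_add_cancel Nat.one_le_two_pow, h, one_mul]
  have hdvd := orderOf_dvd_of_pow_eq_one hpow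
  rw [hg] at hdvd
  have hlt : 2 ^ j < 2 ^ n := Nat.pow_lt_pow_right one_lt_two hj
  have hj1 : 1 ≤ 2 ^ j := Nat.one_le_two_pow
  have hzero := Nat.eq_zero_of_dvd_of_lt hdvd (by omega)
  by_contra hne
  have := Nat.one_lt_two_pow hne
  omega

/-- For fixed `x`, `s`, `r`, the number of `R ∈ D_x` such that the triple `(s, r, R)` is
successful is at most `u_x`. -/
theorem stmt4 {L : Type*} [Field L] [Fintype L] [Algebra (ZMod 2) L]
    (n : ℕ) (hn : 2 ≤ n) (hcard : Fintype.card L = 2 ^ n)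
    (g : L) (hg : orderOf g = 2 ^ n - 1)
    (x s : ℕ) (hx : x < 2 ^ n - 1) (hs : s < 2 ^ n - 1)
    (r : L) (hr : r = 0 ∨ r = 1)
    (Y V W : Polynomial (ZMod 2))
    (hYdeg : Y.degree < (n : WithBot ℕ)) (hYg : aeval g Y = g ^ x)
    (hVdeg : V.degree < (n : WithBot ℕ)) (hVg : aeval g V = g ^ s)
    (hWdeg : W.degree < (n : WithBot ℕ)) (hWg : aeval g W = g ^ (x * s) * (g + r))
    (D : Set L) (hD : D = {β | β ≠ 0 ∧ aeval β Y = β ^ x}) :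
    Set.ncard {R ∈ D | aeval R V ≠ 0 ∧ aeval R W + (aeval R V) ^ x * (g + r) = 0}
      ≤ numOrbits n D := by
  have : CharP L 2 := charP_of_injective_algebraMap (algebraMap (ZMod 2) L).injective 2
  have hg0 : g ≠ 0 := by
    rintro rfl
    have h4 : 2 ^ 2 ≤ 2 ^ n := Nat.pow_le_pow_right two_pos hn
    rw [orderOf_zero] at hg
    omega
  have hDpow : ∀ β ∈ D, frobOrbit n β ⊆ D := by
    subst hD
    rintro β ⟨hβ, hY⟩ _ ⟨j, -, rfl⟩
    exact ⟨pow_ne_zero _ hβ, by rw [aeval_pow_two_pow, hY, pow_right_comm]⟩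
  refine Set.ncard_le_ncard_of_injOn (frobOrbit n) ?_ ?_ (Set.toFinite _)
  · rintro R ⟨hR, -⟩
    exact ⟨⟨R, (hD ▸ hR : R ∈ {β | β ≠ 0 ∧ aeval β Y = β ^ x}).1, rfl⟩, hDpow R hR⟩
  · rintro R ⟨-, hV, hW⟩ R' ⟨-, -, hW'⟩ horb
    obtain ⟨j, hj, rfl⟩ : R' ∈ frobOrbit n R := horb ▸ mem_frobOrbit_self (by omega) R'
    rw [aeval_pow_two_pow, aeval_pow_two_pow, CharTwo.add_eq_zero.1 hW, mul_pow,
      pow_right_comm (aeval R V), ← mul_add] at hW'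
    have hfix := CharTwo.add_eq_zero.1
      ((mul_eq_zero.1 hW').resolve_left (pow_ne_zero _ (pow_ne_zero _ hV)))
    have hr' : r ^ 2 ^ j = r := by rcases hr with rfl | rfl <;> simp
    rw [add_pow_char_pow, hr'] at hfix
    rw [eq_zero_of_pow_two_pow_eq_self hg0 hg hj (add_right_cancel hfix)]
    simp
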